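/- Let e0, e1 be the standard basis of ℂ², set x₊ = (e0+e1)/√2, x₋ = (e0−e1)/√2, Q₊ = |x₊⟩⟨x₊|, Q₋ = |x₋⟩⟨x₋|, and let τ_x = (1/2)(|x₊⊗x₋⟩⟨x₊⊗x₋| + |x₋⊗x₊⟩⟨x₋⊗x₊|). For β ∈ ℝ, define ξ_β = (1/√2)(x₊⊗x₋ + e^{iβ} x₋⊗x₊) ∈ ℂ⁴. Then a 4×4 complex matrix Ω is positive semidefinite with trace 1 and satisfies (Q₊⊗I₂) Ω (Q₊⊗I₂) + (Q₋⊗I₂) Ω (Q₋⊗I₂) = τ_x if and only if Ω lies in the convex hull (over ℝ) of the set { |ξ_β⟩⟨ξ_β| : β ∈ ℝ }. -/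

import Mathlib

open Matrix Kronecker
open scoped ComplexOrder

noncomputable section

/-- The outer product `|u⟩⟨v|` of two vectors. -/
def outer {ι : Type*} (u v : ι → ℂ) : Matrix ι ι ℂ :=
  Matrix.of fun i j => u i * star (v j)

/-- The tensor (Kronecker) product of two qubit vectors. -/
def tens (u v : Fin 2 → ℂ) : Fin 2 × Fin 2 → ℂ := fun p => u p.1 * v p.2

def e0 : Fin 2 → ℂ := ![1, 0]
def e1 : Fin 2 → ℂ := ![0, 1]

/-- `x₊ = (e0 + e1)/√2`. -/
def xp : Fin 2 → ℂ := ((Real.sqrt 2 : ℂ))⁻¹ • (e0 + e1)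
/-- `x₋ = (e0 − e1)/√2`. -/
def xm : Fin 2 → ℂ := ((Real.sqrt 2 : ℂ))⁻¹ • (e0 - e1)

/-- `ξ_β = (1/√2)(x₊⊗x₋ + e^{iβ} x₋⊗x₊)`. -/
def xi (β : ℝ) : Fin 2 × Fin 2 → ℂ :=
  ((Real.sqrt 2 : ℂ))⁻¹ • (tens xp xm + Complex.exp ((β : ℂ) * Complex.I) • tens xm xp)

/-- The Hadamard matrix, exchanging the standard basis and the basis `x₊, x₋`. -/
def hadamardOne : Matrix (Fin 2) (Fin 2) ℂ := ((Real.sqrt 2 : ℂ))⁻¹ • !![1, 1; 1, -1]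

lemma inv_sqrt_two_mul_self : ((Real.sqrt 2 : ℂ))⁻¹ * ((Real.sqrt 2 : ℂ))⁻¹ = 1 / 2 := by
  rw [← mul_inv, ← Complex.ofReal_mul, Real.mul_self_sqrt (by norm_num)]
  norm_num

lemma hadamardOne_mul_self : hadamardOne * hadamardOne = 1 := by
  rw [hadamardOne, smul_mul_smul_comm, inv_sqrt_two_mul_self]
  ext i j
  fin_cases i <;> fin_cases j <;> norm_num [Matrix.mul_apply]

lemma conjTranspose_hadamard : hadamardOneᴴ = hadamardOne := by
  ext i j
  fin_cases i <;> fin_cases j <;> simp [hadamardOne]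

lemma hadamardOne_mulVec_e0 : hadamardOne *ᵥ e0 = xp := by
  ext i
  fin_cases i <;> simp [hadamardOne, xp, e0, e1, Matrix.mulVec, dotProduct]

lemma hadamardOne_mulVec_e1 : hadamardOne *ᵥ e1 = xm := by
  ext i
  fin_cases i <;> simp [hadamardOne, xm, e0, e1, Matrix.mulVec, dotProduct]

/-- The Hadamard matrix acting on both qubits. -/
def hadamardTwo : Matrix (Fin 2 × Fin 2) (Fin 2 × Fin 2) ℂ := hadamardOne ⊗ₖ hadamardOne

lemma hadamardTwo_mul_self : hadamardTwo * hadamardTwo = 1 := by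
  rw [hadamardTwo, ← Matrix.mul_kronecker_mul, hadamardOne_mul_self, Matrix.one_kronecker_one]

lemma conjTranspose_hadamardTwo : hadamardTwoᴴ = hadamardTwo := by
  rw [hadamardTwo, Matrix.conjTranspose_kronecker, conjTranspose_hadamard]

lemma outer_eq_vecMulVec {ι : Type*} (u v : ι → ℂ) : outer u v = vecMulVec u (star v) := rfl

lemma outer_mulVec {ι : Type*} [Fintype ι] (A : Matrix ι ι ℂ) (u v : ι → ℂ) :
    outer (A *ᵥ u) (A *ᵥ v) = A * outer u v * Aᴴ := by
  rw [outer_eq_vecMulVec, outer_eq_vecMulVec, Matrix.mul_vecMulVec, Matrix.vecMulVec_mul,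
    Matrix.star_mulVec]

lemma tens_mulVec (A B : Matrix (Fin 2) (Fin 2) ℂ) (u v : Fin 2 → ℂ) :
    tens (A *ᵥ u) (B *ᵥ v) = (A ⊗ₖ B) *ᵥ tens u v := by
  ext ⟨i, j⟩
  simp [tens, Matrix.mulVec, dotProduct, Fintype.sum_prod_type]
  ring

/-- The matrix whose conjugate by `hadamardTwo` has coherence `z` between `x₊⊗x₋` and `x₋⊗x₊`. -/
def coherenceMatrix (z : ℂ) : Matrix (Fin 2 × Fin 2) (Fin 2 × Fin 2) ℂ :=
  ((1 : ℂ) / 2) • (outer (tens e0 e1) (tens e0 e1) + outer (tens e1 e0) (tens e1 e0) +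
    (z • outer (tens e0 e1) (tens e1 e0) + star z • outer (tens e1 e0) (tens e0 e1)))

/-- The pinching of the first qubit in the standard basis. -/
def pinch (M : Matrix (Fin 2 × Fin 2) (Fin 2 × Fin 2) ℂ) :
    Matrix (Fin 2 × Fin 2) (Fin 2 × Fin 2) ℂ :=
  (outer e0 e0 ⊗ₖ (1 : Matrix (Fin 2) (Fin 2) ℂ)) * M *
      (outer e0 e0 ⊗ₖ (1 : Matrix (Fin 2) (Fin 2) ℂ)) +
    (outer e1 e1 ⊗ₖ (1 : Matrix (Fin 2) (Fin 2) ℂ)) * M *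
      (outer e1 e1 ⊗ₖ (1 : Matrix (Fin 2) (Fin 2) ℂ))

lemma outer_e0 : outer e0 e0 = !![1, 0; 0, 0] := by
  ext i j
  fin_cases i <;> fin_cases j <;> simp [outer, e0]

lemma outer_e1 : outer e1 e1 = !![0, 0; 0, 1] := by
  ext i j
  fin_cases i <;> fin_cases j <;> simp [outer, e1]

lemma pinch_apply (M : Matrix (Fin 2 × Fin 2) (Fin 2 × Fin 2) ℂ) (p q : Fin 2 × Fin 2) :
    pinch M p q = if p.1 = q.1 then M p q else 0 := by
  obtain ⟨i, j⟩ := p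
  obtain ⟨k, l⟩ := q
  rw [pinch, outer_e0, outer_e1]
  fin_cases i <;> fin_cases j <;> fin_cases k <;> fin_cases l <;>
    simp [Matrix.mul_apply, Fintype.sum_prod_type, Matrix.one_apply]

lemma pinch_coherenceMatrix (z : ℂ) : pinch (coherenceMatrix z) = coherenceMatrix 0 := by
  ext ⟨i, j⟩ ⟨k, l⟩
  rw [pinch_apply]
  fin_cases i <;> fin_cases j <;> fin_cases k <;> fin_cases l <;>
    simp [coherenceMatrix, outer, tens, e0, e1]

lemma trace_coherenceMatrix (z : ℂ) : (coherenceMatrix z).trace = 1 := by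
  simp [coherenceMatrix, outer, tens, e0, e1, Matrix.trace, Fintype.sum_prod_type]
  norm_num

lemma Matrix.PosSemidef.normSq_apply_le {n : Type*} {M : Matrix n n ℂ} (hM : M.PosSemidef)
    (i j : n) : Complex.normSq (M i j) ≤ (M i i * M j j).re := by
  have h := (hM.submatrix ![i, j]).det_nonneg
  rw [Matrix.det_fin_two] at h
  have hji : M j i = star (M i j) := (hM.isHermitian.apply j i).symm
  have h' := (Complex.le_def.1 h).1
  simp only [Matrix.submatrix_apply, Matrix.cons_val_zero, Matrix.cons_val_one, hji,
    Complex.star_def, Complex.mul_conj] at h'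
  simpa using h'

lemma eq_coherenceMatrix_of_pinch {M : Matrix (Fin 2 × Fin 2) (Fin 2 × Fin 2) ℂ}
    (hM : M.PosSemidef) (h : pinch M = coherenceMatrix 0) :
    ∃ z : ℂ, ‖z‖ ≤ 1 ∧ M = coherenceMatrix z := by
  have hp : ∀ p q : Fin 2 × Fin 2, p.1 = q.1 → M p q = coherenceMatrix 0 p q := by
    intro p q hpq
    rw [← h, pinch_apply, if_pos hpq]
  have h00 : M (0, 0) (0, 0) = 0 := by
    rw [hp _ _ rfl]; simp [coherenceMatrix, outer, tens, e0, e1]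
  have h11 : M (1, 1) (1, 1) = 0 := by
    rw [hp _ _ rfl]; simp [coherenceMatrix, outer, tens, e0, e1]
  have h01 : M (0, 1) (0, 1) = 1 / 2 := by
    rw [hp _ _ rfl]; simp [coherenceMatrix, outer, tens, e0, e1]
  have h10 : M (1, 0) (1, 0) = 1 / 2 := by
    rw [hp _ _ rfl]; simp [coherenceMatrix, outer, tens, e0, e1]
  have hrow : ∀ p q, M p p = 0 → M p q = 0 := by
    intro p q h0
    have := hM.normSq_apply_le p q
    rw [h0, zero_mul, Complex.zero_re] at this
    exact Complex.normSq_eq_zero.1 (le_antisymm this (Complex.normSq_nonneg _))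
  have hcol : ∀ p q, M q q = 0 → M p q = 0 := by
    intro p q h0
    rw [← hM.isHermitian.apply p q, hrow q p h0, star_zero]
  refine ⟨2 * M (0, 1) (1, 0), ?_, ?_⟩
  · have := hM.normSq_apply_le (0, 1) (1, 0)
    rw [h01, h10, Complex.normSq_eq_norm_sq] at this
    norm_num at this ⊢
    nlinarith [norm_nonneg (M (0, 1) (1, 0))]
  · have hstar : M (1, 0) (0, 1) = star (M (0, 1) (1, 0)) := (hM.isHermitian.apply _ _).symm
    ext ⟨i, j⟩ ⟨k, l⟩
    fin_cases i <;> fin_cases j <;> fin_cases k <;> fin_cases l <;>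
      simp [coherenceMatrix, outer, tens, e0, e1, h01, h10, hstar, hrow _ _ h00, hrow _ _ h11,
        hcol _ _ h00, hcol _ _ h11]

lemma outer_xi (β : ℝ) : outer (xi β) (xi β) =
    hadamardTwo * coherenceMatrix (Complex.exp (-(β : ℂ) * Complex.I)) * hadamardTwo := by
  have hxi : xi β = hadamardTwo *ᵥ (((Real.sqrt 2 : ℂ))⁻¹ •
      (tens e0 e1 + Complex.exp ((β : ℂ) * Complex.I) • tens e1 e0)) := by
    rw [xi, ← hadamardOne_mulVec_e0, ← hadamardOne_mulVec_e1, tens_mulVec, tens_mulVec,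
      Matrix.mulVec_smul, Matrix.mulVec_add, Matrix.mulVec_smul, hadamardTwo]
  have hconj : star (Complex.exp ((β : ℂ) * Complex.I)) = Complex.exp (-(β : ℂ) * Complex.I) := by
    rw [Complex.star_def, ← Complex.exp_conj]
    simp
  have hmul : Complex.exp ((β : ℂ) * Complex.I) * Complex.exp (-(β : ℂ) * Complex.I) = 1 := by
    rw [← Complex.exp_add]
    simp
  have hinv : star ((Real.sqrt 2 : ℂ))⁻¹ = ((Real.sqrt 2 : ℂ))⁻¹ := by simp
  rw [hxi, outer_mulVec, conjTranspose_hadamardTwo]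
  congr 2
  ext p q
  have hs := inv_sqrt_two_mul_self
  have hstar := congrArg star hconj
  rw [star_star] at hstar
  have e01 : ∀ p, star (tens e0 e1 p) = tens e0 e1 p := by
    rintro ⟨i, j⟩; fin_cases i <;> fin_cases j <;> simp [tens, e0, e1]
  have e10 : ∀ p, star (tens e1 e0 p) = tens e1 e0 p := by
    rintro ⟨i, j⟩; fin_cases i <;> fin_cases j <;> simp [tens, e0, e1]
  simp only [outer, coherenceMatrix, Matrix.of_apply, Pi.smul_apply, Pi.add_apply, smul_eq_mul,
    Matrix.smul_apply, Matrix.add_apply, star_mul', star_add, e01, e10, hinv, hconj, ← hstar, ← hs]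
  linear_combination ((Real.sqrt 2 : ℂ))⁻¹ * ((Real.sqrt 2 : ℂ))⁻¹ *
    tens e1 e0 p * tens e1 e0 q * hmul

/-- Conjugation by `hadamardTwo` turns pinching in the basis `x₊, x₋` into standard pinching. -/
lemma pinch_hadamardTwo_conj (M : Matrix (Fin 2 × Fin 2) (Fin 2 × Fin 2) ℂ) :
    (outer xp xp ⊗ₖ (1 : Matrix (Fin 2) (Fin 2) ℂ)) * (hadamardTwo * M * hadamardTwo) *
          (outer xp xp ⊗ₖ (1 : Matrix (Fin 2) (Fin 2) ℂ)) +
        (outer xm xm ⊗ₖ (1 : Matrix (Fin 2) (Fin 2) ℂ)) * (hadamardTwo * M * hadamardTwo) *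
          (outer xm xm ⊗ₖ (1 : Matrix (Fin 2) (Fin 2) ℂ)) =
      hadamardTwo * pinch M * hadamardTwo := by
  have key : ∀ u : Fin 2 → ℂ, outer (hadamardOne *ᵥ u) (hadamardOne *ᵥ u) ⊗ₖ
      (1 : Matrix (Fin 2) (Fin 2) ℂ) = hadamardTwo * (outer u u ⊗ₖ 1) * hadamardTwo := by
    intro u
    rw [outer_mulVec, conjTranspose_hadamard, hadamardTwo, ← Matrix.mul_kronecker_mul,
      ← Matrix.mul_kronecker_mul, mul_one, hadamardOne_mul_self]
  have cancel : ∀ A : Matrix (Fin 2 × Fin 2) (Fin 2 × Fin 2) ℂ,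
      hadamardTwo * (hadamardTwo * A) = A := by
    intro A
    rw [← mul_assoc, hadamardTwo_mul_self, one_mul]
  rw [← hadamardOne_mulVec_e0, ← hadamardOne_mulVec_e1, key, key, pinch]
  simp only [mul_assoc, cancel, mul_add, add_mul]

lemma tau_eq : ((1 : ℂ)/2) • (outer (tens xp xm) (tens xp xm) + outer (tens xm xp) (tens xm xp)) =
    hadamardTwo * coherenceMatrix 0 * hadamardTwo := by
  rw [← hadamardOne_mulVec_e0, ← hadamardOne_mulVec_e1, tens_mulVec, tens_mulVec, outer_mulVec,
    outer_mulVec, ← hadamardTwo, conjTranspose_hadamardTwo]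
  simp [coherenceMatrix, mul_add, add_mul]

lemma hadamardTwo_conj_conj (M : Matrix (Fin 2 × Fin 2) (Fin 2 × Fin 2) ℂ) :
    hadamardTwo * (hadamardTwo * M * hadamardTwo) * hadamardTwo = M := by
  rw [mul_assoc, mul_assoc (hadamardTwo * M), hadamardTwo_mul_self, mul_one, ← mul_assoc,
    hadamardTwo_mul_self, one_mul]

/-- A point of the closed unit disc is the midpoint of two points of the unit circle. -/
lemma exists_exp_midpoint {z : ℂ} (hz : ‖z‖ ≤ 1) : ∃ α β : ℝ,
    z = ((1 : ℂ) / 2) * (Complex.exp (-(α : ℂ) * Complex.I) +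
      Complex.exp (-(β : ℂ) * Complex.I)) := by
  refine ⟨-(z.arg + Real.arccos ‖z‖), -(z.arg - Real.arccos ‖z‖), ?_⟩
  have hcos : Complex.cos (Real.arccos ‖z‖ : ℝ) = (‖z‖ : ℂ) := by
    rw [← Complex.ofReal_cos, Real.cos_arccos (by linarith [norm_nonneg z]) hz]
  rw [Complex.cos] at hcos
  conv_lhs => rw [← Complex.norm_mul_exp_arg_mul_I z, ← hcos]
  push_cast
  rw [neg_neg, neg_neg, add_mul, sub_mul, Complex.exp_add, sub_eq_add_neg, Complex.exp_add, neg_mul]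
  ring

lemma coherenceMatrix_midpoint (z w : ℂ) : coherenceMatrix (((1 : ℂ) / 2) * (z + w)) =
    ((1 : ℝ) / 2) • coherenceMatrix z + ((1 : ℝ) / 2) • coherenceMatrix w := by
  ext p q
  simp [coherenceMatrix]
  ring

/-- The density matrices with a prescribed image under an additive, real-homogeneous map form a
convex set. -/
lemma convex_posSemidef_trace_map (f : Matrix (Fin 2 × Fin 2) (Fin 2 × Fin 2) ℂ →ₗ[ℝ]
      Matrix (Fin 2 × Fin 2) (Fin 2 × Fin 2) ℂ)
    (τ : Matrix (Fin 2 × Fin 2) (Fin 2 × Fin 2) ℂ) :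
    Convex ℝ {Ω | Ω.PosSemidef ∧ Ω.trace = 1 ∧ f Ω = τ} := by
  rintro A ⟨hA, hA1, hA2⟩ B ⟨hB, hB1, hB2⟩ a b ha hb hab
  refine ⟨(hA.smul ha).add (hB.smul hb), ?_, ?_⟩
  · rw [Matrix.trace_add, Matrix.trace_smul, Matrix.trace_smul, hA1, hB1, ← add_smul, hab, one_smul]
  · rw [map_add, map_smul, map_smul, hA2, hB2, ← add_smul, hab, one_smul]

theorem scenario_two_solution_set
    (Ω : Matrix (Fin 2 × Fin 2) (Fin 2 × Fin 2) ℂ) :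
    (Ω.PosSemidef ∧ Ω.trace = 1 ∧
      (outer xp xp ⊗ₖ (1 : Matrix (Fin 2) (Fin 2) ℂ)) * Ω *
          (outer xp xp ⊗ₖ (1 : Matrix (Fin 2) (Fin 2) ℂ)) +
        (outer xm xm ⊗ₖ (1 : Matrix (Fin 2) (Fin 2) ℂ)) * Ω *
          (outer xm xm ⊗ₖ (1 : Matrix (Fin 2) (Fin 2) ℂ))
        = ((1 : ℂ)/2) • (outer (tens xp xm) (tens xp xm) + outer (tens xm xp) (tens xm xp)))
    ↔ Ω ∈ convexHull ℝ {M | ∃ β : ℝ, M = outer (xi β) (xi β)} := by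
  constructor
  · rintro ⟨hpos, -, hpinch⟩
    rw [← hadamardTwo_conj_conj Ω, pinch_hadamardTwo_conj, tau_eq] at hpinch
    have hp := congrArg (fun A => hadamardTwo * A * hadamardTwo) hpinch
    simp only [hadamardTwo_conj_conj] at hp
    have hM : (hadamardTwo * Ω * hadamardTwo).PosSemidef := by
      have := hpos.mul_mul_conjTranspose_same hadamardTwo
      rwa [conjTranspose_hadamardTwo] at this
    obtain ⟨z, hz, hMz⟩ := eq_coherenceMatrix_of_pinch hM hp
    obtain ⟨α, β, rfl⟩ := exists_exp_midpoint hz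
    have hΩ : Ω = ((1 : ℝ) / 2) • outer (xi α) (xi α) + ((1 : ℝ) / 2) • outer (xi β) (xi β) := by
      rw [← hadamardTwo_conj_conj Ω, hMz, coherenceMatrix_midpoint, outer_xi, outer_xi,
        mul_add, add_mul, mul_smul_comm, mul_smul_comm, smul_mul_assoc, smul_mul_assoc]
    rw [hΩ]
    have hmem : ∀ γ : ℝ, outer (xi γ) (xi γ) ∈
        convexHull ℝ {M | ∃ β : ℝ, M = outer (xi β) (xi β)} :=
      fun γ => subset_convexHull ℝ _ ⟨γ, rfl⟩
    exact convex_convexHull ℝ _ (hmem α) (hmem β) (by norm_num) (by norm_num) (by norm_num)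
  · let f : Matrix (Fin 2 × Fin 2) (Fin 2 × Fin 2) ℂ →ₗ[ℝ]
        Matrix (Fin 2 × Fin 2) (Fin 2 × Fin 2) ℂ :=
      LinearMap.mulLeftRight ℝ (outer xp xp ⊗ₖ 1, outer xp xp ⊗ₖ 1) +
        LinearMap.mulLeftRight ℝ (outer xm xm ⊗ₖ 1, outer xm xm ⊗ₖ 1)
    intro hΩ
    refine convexHull_min ?_ (convex_posSemidef_trace_map f _) hΩ
    rintro _ ⟨β, rfl⟩
    refine ⟨Matrix.posSemidef_vecMulVec_self_star (xi β), ?_, ?_⟩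
    · rw [outer_xi, Matrix.trace_mul_comm, ← mul_assoc, hadamardTwo_mul_self, one_mul,
        trace_coherenceMatrix]
    · simp only [f, LinearMap.add_apply, LinearMap.mulLeftRight_apply]
      rw [outer_xi, pinch_hadamardTwo_conj, pinch_coherenceMatrix, tau_eq]
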